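/- arXiv:2509.17554 — 4 statements merged into one kernel-verified Lean document; each statement's English description precedes it below -/
import Mathlib

section
/- (Geometric mixing of time-varying doubly stochastic matrices, Lemma 2.) Assume the network assumption. For t ≥ s ≥ 1 let Q(t,s) := P_t P_{t−1} ⋯ P_s be the transition matrix. Then for all i, j ∈ {1,…,m} and all t ≥ s ≥ 1: |[Q(t,s)]_{ij} − 1/m| ≤ ω γ^{t−s}, where ω := (1 − ζ/(4m²))^{−2} and γ := (1 − ζ/(4m²))^{1/B₀}. -/
open Finset

/-- The network assumption: each `P t` is doubly stochastic, diagonal entries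
and nonzero entries are bounded below by `ζ ∈ (0,1)`, and over every window of
`B₀` consecutive times the union communication graph is strongly connected. -/
def NetworkAssumption (m : ℕ) (P : ℕ → Matrix (Fin m) (Fin m) ℝ)
    (ζ : ℝ) (B₀ : ℕ) : Prop :=
  (∀ t i j, 0 ≤ P t i j) ∧
  (∀ t i, ∑ j, P t i j = 1) ∧
  (∀ t j, ∑ i, P t i j = 1) ∧
  0 < ζ ∧ ζ < 1 ∧ 1 ≤ B₀ ∧
  (∀ t i, ζ ≤ P t i i) ∧
  (∀ t i j, P t i j ≠ 0 → ζ ≤ P t i j) ∧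
  (∀ k : ℕ, ∀ a b : Fin m,
    Relation.ReflTransGen
      (fun j i => ∃ t, k * B₀ < t ∧ t ≤ (k + 1) * B₀ ∧ 0 < P t i j) a b)

/-- The transition matrix `Q(s+k, s) = P_{s+k} P_{s+k-1} ⋯ P_s`, parametrized
by the starting time `s` and the number of extra steps `k`. -/
def transQ {m : ℕ} (P : ℕ → Matrix (Fin m) (Fin m) ℝ) (s : ℕ) :
    ℕ → Matrix (Fin m) (Fin m) ℝ
  | 0 => P s
  | k + 1 => P (s + k + 1) * transQ P s k

/-- The matrix `A` has a positive entry joining the two sides of the cut `{i | r i ≤ d}`. -/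
def CrossesCut {ι : Type*} (A : Matrix ι ι ℝ) (r : ι → ℕ) (d : ℕ) : Prop :=
  ∃ l j, 0 < A l j ∧ ¬(r l ≤ d ↔ r j ≤ d)

/-- The two sides of the cut at `d` are separated in value by the interval `[y d, y (d + 1)]`. -/
def SeparatesAt {ι : Type*} (x : ι → ℝ) (r : ι → ℕ) (y : ℕ → ℝ) (d : ℕ) : Prop :=
  ∀ i, (r i ≤ d → x i ≤ y d) ∧ (d < r i → y (d + 1) ≤ x i)

/-- Averaging with a matrix that does not cross a cut preserves separation of values. -/
lemma SeparatesAt.mulVec {ι : Type*} [Fintype ι] {A : Matrix ι ι ℝ}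
    (hA : ∀ i j, 0 ≤ A i j) (hrow : ∀ i, ∑ j, A i j = 1) {x : ι → ℝ} {r : ι → ℕ}
    {y : ℕ → ℝ} {d : ℕ} (h : SeparatesAt x r y d) (hc : ¬CrossesCut A r d) :
    SeparatesAt (A.mulVec x) r y d := by
  have hc' : ∀ l j, 0 < A l j → (r l ≤ d ↔ r j ≤ d) := by
    intro l j hlj
    by_contra hn
    exact hc ⟨l, j, hlj, hn⟩
  intro l
  have hconst : ∀ c : ℝ, ∑ j, A l j * c = c := fun c => by
    rw [← Finset.sum_mul, hrow, one_mul]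
  constructor
  · intro hl
    rw [← hconst (y d)]
    refine Finset.sum_le_sum fun j _ => ?_
    rcases (hA l j).eq_or_lt with h0 | h0
    · simp [← h0]
    · exact mul_le_mul_of_nonneg_left ((h j).1 ((hc' l j h0).1 hl)) h0.le
  · intro hl
    rw [← hconst (y (d + 1))]
    refine Finset.sum_le_sum fun j _ => ?_
    rcases (hA l j).eq_or_lt with h0 | h0
    · simp [← h0]
    · refine mul_le_mul_of_nonneg_left ((h j).2 ?_) h0.le
      have := hc' l j h0
      omega

/-- If cuts in `F` all lie between two nodes, the sum of the squared gaps is at most the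
squared difference of the values. -/
lemma sum_sq_gap_le_sq_sub {ι : Type*} {x : ι → ℝ} {r : ι → ℕ} {y : ℕ → ℝ}
    (hy : Monotone y) {F : Finset ℕ} {i j : ι} (hF : ∀ d ∈ F, SeparatesAt x r y d)
    (hij : ∀ d ∈ F, r i ≤ d ∧ d < r j) :
    ∑ d ∈ F, (y (d + 1) - y d) ^ 2 ≤ (x i - x j) ^ 2 := by
  have hgap : ∀ d, 0 ≤ y (d + 1) - y d := fun d => sub_nonneg.2 (hy d.le_succ)
  rcases F.eq_empty_or_nonempty with rfl | hne
  · simpa using sq_nonneg (x i - x j)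
  set a := F.min' hne
  set b := F.max' hne
  have hab : a ≤ b := F.min'_le _ (F.max'_mem hne)
  have h1 : x i ≤ y a :=
    (hF a (F.min'_mem hne) i).1 (hij a (F.min'_mem hne)).1
  have h2 : y (b + 1) ≤ x j :=
    (hF b (F.max'_mem hne) j).2 (hij b (F.max'_mem hne)).2
  have h3 : ∑ d ∈ F, (y (d + 1) - y d) ≤ y (b + 1) - y a := by
    rw [← Finset.sum_Ico_sub y (by omega : a ≤ b + 1)]
    refine Finset.sum_le_sum_of_subset_of_nonneg (fun d hd => ?_) fun d _ _ => hgap d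
    rw [Finset.mem_Ico]
    exact ⟨F.min'_le d hd, Nat.lt_succ_of_le (F.le_max' d hd)⟩
  have h4 : 0 ≤ ∑ d ∈ F, (y (d + 1) - y d) := Finset.sum_nonneg fun d _ => hgap d
  calc ∑ d ∈ F, (y (d + 1) - y d) ^ 2
      ≤ (∑ d ∈ F, (y (d + 1) - y d)) ^ 2 :=
        Finset.sum_sq_le_sq_sum_of_nonneg fun d _ => hgap d
    _ ≤ (x j - x i) ^ 2 := pow_le_pow_left₀ h4 (by linarith) 2
    _ = (x i - x j) ^ 2 := by ring

/-- The variance of `x` under a probability vector `a`, as a sum over pairs. -/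
lemma two_mul_variance_eq_sum_pairs {ι : Type*} [Fintype ι] {a : ι → ℝ}
    (ha : ∑ j, a j = 1) (x : ι → ℝ) :
    2 * (∑ j, a j * x j ^ 2 - (∑ j, a j * x j) ^ 2) =
      ∑ i, ∑ j, a i * a j * (x i - x j) ^ 2 := by
  have h : ∀ i j, a i * a j * (x i - x j) ^ 2 =
      a i * x i ^ 2 * a j + a i * (a j * x j ^ 2) - 2 * ((a i * x i) * (a j * x j)) := by
    intro i j; ring
  simp_rw [h, Finset.sum_sub_distrib, Finset.sum_add_distrib, ← Finset.mul_sum,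
    ← Finset.sum_mul, ha]
  ring

/-- The variance of `x` under a probability vector dominates the squared gaps of separating
cuts, weighted by the product of the masses of the two sides. -/
lemma sum_gap_sq_mul_mass_le_variance {ι : Type*} [Fintype ι] {a : ι → ℝ}
    (h0 : ∀ j, 0 ≤ a j) (ha : ∑ j, a j = 1) {x : ι → ℝ} {r : ι → ℕ} {y : ℕ → ℝ}
    (hy : Monotone y) {D : Finset ℕ} (hD : ∀ d ∈ D, SeparatesAt x r y d) :
    ∑ d ∈ D, (y (d + 1) - y d) ^ 2 *
        ((∑ j with r j ≤ d, a j) * ∑ j with ¬r j ≤ d, a j) ≤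
      ∑ j, a j * x j ^ 2 - (∑ j, a j * x j) ^ 2 := by
  have hpair : ∀ i j, ∑ d ∈ D with ¬(r i ≤ d ↔ r j ≤ d), (y (d + 1) - y d) ^ 2 ≤
      (x i - x j) ^ 2 := by
    intro i j
    rcases le_total (r i) (r j) with h | h
    · refine sum_sq_gap_le_sq_sub (r := r) hy (fun d hd => hD d (Finset.mem_filter.1 hd).1) ?_
      intro d hd
      have := (Finset.mem_filter.1 hd).2
      omega
    · rw [← neg_sq (x i - x j), neg_sub]
      refine sum_sq_gap_le_sq_sub (r := r) hy (fun d hd => hD d (Finset.mem_filter.1 hd).1) ?_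
      intro d hd
      have := (Finset.mem_filter.1 hd).2
      omega
  have hcut : ∀ d, ∑ i, ∑ j, a i * a j * (if ¬(r i ≤ d ↔ r j ≤ d) then (1 : ℝ) else 0) =
      2 * ((∑ j with r j ≤ d, a j) * ∑ j with ¬r j ≤ d, a j) := by
    intro d
    have h : ∀ i j, a i * a j * (if ¬(r i ≤ d ↔ r j ≤ d) then (1 : ℝ) else 0) =
        (if r i ≤ d then a i else 0) * (if ¬r j ≤ d then a j else 0) +
        (if ¬r i ≤ d then a i else 0) * (if r j ≤ d then a j else 0) := by
      intro i j
      by_cases hi : r i ≤ d <;> by_cases hj : r j ≤ d <;> simp [hi, hj]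
    simp_rw [h, Finset.sum_add_distrib, ← Finset.mul_sum, ← Finset.sum_mul,
      Finset.sum_filter]
    ring
  have key : 2 * ∑ d ∈ D, (y (d + 1) - y d) ^ 2 *
        ((∑ j with r j ≤ d, a j) * ∑ j with ¬r j ≤ d, a j) ≤
      ∑ i, ∑ j, a i * a j * (x i - x j) ^ 2 := by
    calc _ = ∑ d ∈ D, ∑ i, ∑ j, a i * a j *
          (if ¬(r i ≤ d ↔ r j ≤ d) then (y (d + 1) - y d) ^ 2 else 0) := by
          rw [Finset.mul_sum]
          refine Finset.sum_congr rfl fun d _ => ?_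
          rw [mul_left_comm, ← hcut d, Finset.mul_sum]
          refine Finset.sum_congr rfl fun i _ => ?_
          rw [Finset.mul_sum]
          refine Finset.sum_congr rfl fun j _ => ?_
          split_ifs <;> ring
      _ = ∑ i, ∑ j, a i * a j *
          ∑ d ∈ D with ¬(r i ≤ d ↔ r j ≤ d), (y (d + 1) - y d) ^ 2 := by
          rw [Finset.sum_comm]
          refine Finset.sum_congr rfl fun i _ => ?_
          rw [Finset.sum_comm]
          refine Finset.sum_congr rfl fun j _ => ?_
          rw [Finset.sum_filter, Finset.mul_sum]
      _ ≤ _ := Finset.sum_le_sum fun i _ => Finset.sum_le_sum fun j _ =>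
          mul_le_mul_of_nonneg_left (hpair i j) (mul_nonneg (h0 i) (h0 j))
  rw [← two_mul_variance_eq_sum_pairs ha] at key
  linarith

/-- A crossed cut has total weight at least `ζ / 2` in `Aᵀ * A`. -/
lemma CrossesCut.half_le_sum_mass {ι : Type*} [Fintype ι] {A : Matrix ι ι ℝ} {ζ : ℝ}
    (hA : ∀ i j, 0 ≤ A i j) (hrow : ∀ i, ∑ j, A i j = 1) (hζ : 0 < ζ)
    (hdiag : ∀ i, ζ ≤ A i i) (hpos : ∀ i j, A i j ≠ 0 → ζ ≤ A i j) {r : ι → ℕ} {d : ℕ}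
    (hc : CrossesCut A r d) :
    ζ / 2 ≤ ∑ l, (∑ j with r j ≤ d, A l j) * ∑ j with ¬r j ≤ d, A l j := by
  obtain ⟨l, j, hlj, hcut⟩ := hc
  have hsum := Finset.sum_filter_add_sum_filter_not Finset.univ (fun j => r j ≤ d) (A l)
  rw [hrow] at hsum
  have hmem : ∀ (p : ι → Prop) [DecidablePred p] (i : ι), p i → A l i ≤ ∑ j with p j, A l j :=
    fun p _ i hi => Finset.single_le_sum (f := A l) (fun j _ => hA l j) (by simp [hi])
  have hle : ζ ≤ ∑ j with r j ≤ d, A l j ∧ ζ ≤ ∑ j with ¬r j ≤ d, A l j := by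
    by_cases hl : r l ≤ d
    · have hj : ¬r j ≤ d := fun h => hcut (iff_of_true hl h)
      exact ⟨(hdiag l).trans (hmem _ l hl), (hpos l j hlj.ne').trans (hmem _ j hj)⟩
    · have hj : r j ≤ d := by
        by_contra h
        exact hcut (iff_of_false hl h)
      exact ⟨(hpos l j hlj.ne').trans (hmem _ j hj), (hdiag l).trans (hmem _ l hl)⟩
  refine le_trans ?_ (Finset.single_le_sum
    (f := fun l => (∑ j with r j ≤ d, A l j) * ∑ j with ¬r j ≤ d, A l j)
    (fun l _ => mul_nonneg (Finset.sum_nonneg fun j _ => hA l j)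
      (Finset.sum_nonneg fun j _ => hA l j)) (Finset.mem_univ l))
  obtain ⟨h1, h2⟩ := hle
  generalize ∑ j with r j ≤ d, A l j = p at *
  generalize ∑ j with ¬r j ≤ d, A l j = q at *
  rcases le_total p q with h | h <;> nlinarith

/-- One averaging step decreases the sum of squares by the squared gaps at crossed cuts. -/
lemma sum_sq_mulVec_add_gap_le {ι : Type*} [Fintype ι] {A : Matrix ι ι ℝ} {ζ : ℝ}
    (hA : ∀ i j, 0 ≤ A i j) (hrow : ∀ i, ∑ j, A i j = 1) (hcol : ∀ j, ∑ i, A i j = 1)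
    (hζ : 0 < ζ) (hdiag : ∀ i, ζ ≤ A i i) (hpos : ∀ i j, A i j ≠ 0 → ζ ≤ A i j)
    {x : ι → ℝ} {r : ι → ℕ} {y : ℕ → ℝ} (hy : Monotone y) {D : Finset ℕ}
    (hD : ∀ d ∈ D, SeparatesAt x r y d) (hcross : ∀ d ∈ D, CrossesCut A r d) :
    ∑ i, A.mulVec x i ^ 2 + ζ / 2 * ∑ d ∈ D, (y (d + 1) - y d) ^ 2 ≤ ∑ i, x i ^ 2 := by
  have hvar := Finset.sum_le_sum fun l (_ : l ∈ Finset.univ) =>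
    sum_gap_sq_mul_mass_le_variance (hA l) (hrow l) hy hD
  have hsq : ∑ l, ∑ j, A l j * x j ^ 2 = ∑ j, x j ^ 2 := by
    rw [Finset.sum_comm]
    simp_rw [← Finset.sum_mul, hcol, one_mul]
  rw [Finset.sum_sub_distrib, hsq, Finset.sum_comm] at hvar
  have hgap : ζ / 2 * ∑ d ∈ D, (y (d + 1) - y d) ^ 2 ≤
      ∑ d ∈ D, ∑ l, (y (d + 1) - y d) ^ 2 *
        ((∑ j with r j ≤ d, A l j) * ∑ j with ¬r j ≤ d, A l j) := by
    rw [Finset.mul_sum]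
    refine Finset.sum_le_sum fun d hd => ?_
    rw [← Finset.mul_sum, mul_comm]
    exact mul_le_mul_of_nonneg_left
      ((hcross d hd).half_le_sum_mass hA hrow hζ hdiag hpos) (sq_nonneg _)
  have hmul : ∑ i, A.mulVec x i ^ 2 = ∑ l, (∑ j, A l j * x j) ^ 2 := rfl
  linarith

/-- Every real vector can be written as a monotone sequence composed with a ranking. -/
lemma exists_rank_monotone {m : ℕ} (hm : 1 ≤ m) (x : Fin m → ℝ) :
    ∃ (r : Fin m → ℕ) (y : ℕ → ℝ), Monotone y ∧ (∀ i, x i = y (r i)) ∧ (∀ i, r i < m) ∧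
      ∀ d < m, ∃ i, r i = d := by
  have hlt : ∀ n, min n (m - 1) < m := fun n => by omega
  refine ⟨fun i => ((Tuple.sort x).symm i : ℕ),
    fun n => x (Tuple.sort x ⟨min n (m - 1), hlt n⟩), ?_, ?_, fun i => Fin.isLt _, ?_⟩
  · intro a b hab
    refine Tuple.monotone_sort x ?_
    exact min_le_min_right _ hab
  · intro i
    have h : (⟨min ((Tuple.sort x).symm i : ℕ) (m - 1), hlt _⟩ : Fin m) =
        (Tuple.sort x).symm i := by
      ext
      have := ((Tuple.sort x).symm i).isLt
      simp only
      omega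
    simp only [h, Equiv.apply_symm_apply]
  · intro d hd
    exact ⟨Tuple.sort x ⟨d, hd⟩, by simp⟩

/-- A zero-sum vector has its sum of squares bounded by the squared consecutive gaps of its
sorted values. -/
lemma sum_sq_le_sum_gap_sq {m : ℕ} {x : Fin m → ℝ} (hx : ∑ i, x i = 0)
    {r : Fin m → ℕ} {y : ℕ → ℝ} (hy : Monotone y) (hxy : ∀ i, x i = y (r i))
    (hr : ∀ i, r i < m) :
    ∑ i, x i ^ 2 ≤ (m : ℝ) ^ 2 * ∑ d ∈ Finset.range (m - 1), (y (d + 1) - y d) ^ 2 := by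
  have hdiff : ∀ i j, x i - x j ≤ y (m - 1) - y 0 := by
    intro i j
    rw [hxy i, hxy j]
    have := hr i
    exact sub_le_sub (hy (by omega)) (hy (Nat.zero_le _))
  have hgap : (y (m - 1) - y 0) ^ 2 ≤
      m * ∑ d ∈ Finset.range (m - 1), (y (d + 1) - y d) ^ 2 := by
    have h := sq_sum_le_card_mul_sum_sq (s := Finset.range (m - 1))
      (f := fun d => y (d + 1) - y d)
    rw [Finset.sum_range_sub, Finset.card_range] at h
    refine h.trans (mul_le_mul_of_nonneg_right ?_ (Finset.sum_nonneg fun d _ => sq_nonneg _))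
    exact_mod_cast Nat.sub_le m 1
  have hentry : ∀ i, x i ^ 2 ≤ (y (m - 1) - y 0) ^ 2 := by
    intro i
    have hm : (0 : ℝ) < m := by exact_mod_cast (Nat.zero_le _).trans_lt (hr i)
    have h1 : ∑ j, (x i - x j) ≤ ∑ _j : Fin m, (y (m - 1) - y 0) :=
      Finset.sum_le_sum fun j _ => hdiff i j
    have h2 : ∑ j, (x j - x i) ≤ ∑ _j : Fin m, (y (m - 1) - y 0) :=
      Finset.sum_le_sum fun j _ => hdiff j i
    simp only [Finset.sum_sub_distrib, hx, Finset.sum_const, Finset.card_univ,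
      Fintype.card_fin, nsmul_eq_mul] at h1 h2
    refine sq_le_sq' ?_ ?_ <;> refine le_of_mul_le_mul_left ?_ hm <;> linarith
  calc ∑ i, x i ^ 2 ≤ ∑ _i : Fin m, (y (m - 1) - y 0) ^ 2 :=
        Finset.sum_le_sum fun i _ => hentry i
    _ = m * (y (m - 1) - y 0) ^ 2 := by simp
    _ ≤ m * (m * ∑ d ∈ Finset.range (m - 1), (y (d + 1) - y d) ^ 2) :=
        mul_le_mul_of_nonneg_left hgap (Nat.cast_nonneg m)
    _ = _ := by ring

/-- Over several averaging steps, the sum of squares decreases by the squared initial gaps at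
all cuts crossed so far, and the cuts not yet crossed still separate the values. -/
lemma sum_sq_add_gap_le_of_steps {ι : Type*} [Fintype ι] {A : ℕ → Matrix ι ι ℝ} {ζ : ℝ}
    (hA : ∀ n i j, 0 ≤ A n i j) (hrow : ∀ n i, ∑ j, A n i j = 1)
    (hcol : ∀ n j, ∑ i, A n i j = 1) (hζ : 0 < ζ) (hdiag : ∀ n i, ζ ≤ A n i i)
    (hpos : ∀ n i j, A n i j ≠ 0 → ζ ≤ A n i j) {u : ℕ → ι → ℝ}
    (hu : ∀ n, u (n + 1) = (A n).mulVec (u n)) {r : ι → ℕ} {y : ℕ → ℝ} (hy : Monotone y)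
    (hxy : ∀ i, u 0 i = y (r i)) (n : ℕ) :
    (∀ d, (∀ t < n, ¬CrossesCut (A t) r d) → SeparatesAt (u n) r y d) ∧
    ∀ C : Finset ℕ, (∀ d ∈ C, ∃ t < n, CrossesCut (A t) r d) →
      ∑ i, u n i ^ 2 + ζ / 2 * ∑ d ∈ C, (y (d + 1) - y d) ^ 2 ≤ ∑ i, u 0 i ^ 2 := by
  classical
  induction n with
  | zero =>
    refine ⟨fun d _ i => ?_, fun C hC => ?_⟩
    · rw [hxy]
      exact ⟨fun h => hy h, fun h => hy h⟩
    · have : C = ∅ := Finset.eq_empty_of_forall_notMem fun d hd => by simpa using hC d hd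
      simp [this]
  | succ n ih =>
    obtain ⟨ihsep, ihsum⟩ := ih
    rw [hu]
    refine ⟨fun d hd => ?_, fun C hC => ?_⟩
    · exact (ihsep d fun t ht => hd t (by omega)).mulVec (hA n) (hrow n) (hd n n.lt_succ_self)
    · have hold := ihsum {d ∈ C | ∃ t < n, CrossesCut (A t) r d}
        fun d hd => (Finset.mem_filter.1 hd).2
      have hnew := sum_sq_mulVec_add_gap_le (hA n) (hrow n) (hcol n) hζ (hdiag n) (hpos n) hy
        (D := {d ∈ C | ¬∃ t < n, CrossesCut (A t) r d})
        (fun d hd => ihsep d fun t ht hc => (Finset.mem_filter.1 hd).2 ⟨t, ht, hc⟩)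
        (fun d hd => by
          obtain ⟨hdC, hnot⟩ := Finset.mem_filter.1 hd
          obtain ⟨t, ht, hc⟩ := hC d hdC
          rcases Nat.lt_succ_iff_lt_or_eq.1 ht with h | rfl
          · exact absurd ⟨t, h, hc⟩ hnot
          · exact hc)
      rw [← Finset.sum_filter_add_sum_filter_not C (fun d => ∃ t < n, CrossesCut (A t) r d)]
      linarith

/-- A relation that connects two nodes on different sides of a set has a pair of related nodes
on different sides. -/
lemma Relation.ReflTransGen.exists_crossing {α : Type*} {R : α → α → Prop} {p : α → Prop}
    {a b : α} (h : Relation.ReflTransGen R a b) (hab : ¬(p a ↔ p b)) :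
    ∃ c d, R c d ∧ ¬(p c ↔ p d) := by
  induction h with
  | refl => exact absurd Iff.rfl hab
  | @tail c d _ hcd ih =>
    by_cases hac : p a ↔ p c
    · exact ⟨c, d, hcd, fun h => hab (hac.trans h)⟩
    · exact ih hac

/-- Over a complete connectivity window, the sum of squares of a zero-sum vector contracts. -/
lemma NetworkAssumption.sum_sq_window_le {m : ℕ} (hm : 1 ≤ m)
    {P : ℕ → Matrix (Fin m) (Fin m) ℝ} {ζ : ℝ} {B₀ : ℕ} (hnet : NetworkAssumption m P ζ B₀)
    (q : ℕ) {u : ℕ → Fin m → ℝ} (hu : ∀ n, u (n + 1) = (P (q * B₀ + 1 + n)).mulVec (u n))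
    (h0 : ∑ i, u 0 i = 0) :
    ∑ i, u B₀ i ^ 2 ≤ (1 - ζ / (4 * (m : ℝ) ^ 2)) ^ 2 * ∑ i, u 0 i ^ 2 := by
  obtain ⟨hA, hrow, hcol, hζ, -, -, hdiag, hpos, hconn⟩ := hnet
  obtain ⟨r, y, hy, hxy, hr, hsurj⟩ := exists_rank_monotone hm (u 0)
  have hcross : ∀ d ∈ Finset.range (m - 1),
      ∃ t < B₀, CrossesCut (P (q * B₀ + 1 + t)) r d := by
    intro d hd
    rw [Finset.mem_range] at hd
    obtain ⟨a, ha⟩ := hsurj d (by omega)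
    obtain ⟨b, hb⟩ := hsurj (d + 1) (by omega)
    obtain ⟨j, i, ⟨t, ht1, ht2, hP⟩, hji⟩ :=
      (hconn q a b).exists_crossing (p := fun i => r i ≤ d) (by simp [ha, hb])
    rw [add_mul, one_mul] at ht2
    refine ⟨t - (q * B₀ + 1), by omega, i, j, ?_, fun h => hji h.symm⟩
    rwa [show q * B₀ + 1 + (t - (q * B₀ + 1)) = t by omega]
  have hdec := (sum_sq_add_gap_le_of_steps (A := fun n => P (q * B₀ + 1 + n))
    (fun n => hA _) (fun n => hrow _) (fun n => hcol _) hζ (fun n => hdiag _)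
    (fun n => hpos _) hu hy hxy B₀).2 _ hcross
  have hsq := sum_sq_le_sum_gap_sq h0 hy hxy hr
  have hm2 : (0 : ℝ) < (m : ℝ) ^ 2 := by positivity
  have hgap : ζ / (2 * (m : ℝ) ^ 2) * ∑ i, u 0 i ^ 2 ≤
      ζ / 2 * ∑ d ∈ Finset.range (m - 1), (y (d + 1) - y d) ^ 2 := by
    refine (mul_le_mul_of_nonneg_left hsq (by positivity)).trans_eq ?_
    field_simp
  have hone : 1 - ζ / (2 * (m : ℝ) ^ 2) ≤ (1 - ζ / (4 * (m : ℝ) ^ 2)) ^ 2 := by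
    have : ζ / (2 * (m : ℝ) ^ 2) = 2 * (ζ / (4 * (m : ℝ) ^ 2)) := by
      field_simp
      norm_num
    rw [this]
    nlinarith [sq_nonneg (ζ / (4 * (m : ℝ) ^ 2))]
  have := mul_le_mul_of_nonneg_right hone
    (Finset.sum_nonneg fun i _ => sq_nonneg (u 0 i) : 0 ≤ ∑ i, u 0 i ^ 2)
  linarith

/-- The sum of squares of a zero-sum vector decays geometrically in the number of complete
connectivity windows, at most two windows' worth of steps being lost. -/
lemma NetworkAssumption.exists_sum_sq_le_pow {m : ℕ} (hm : 1 ≤ m)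
    {P : ℕ → Matrix (Fin m) (Fin m) ℝ} {ζ : ℝ} {B₀ : ℕ} (hnet : NetworkAssumption m P ζ B₀)
    {s : ℕ} (hs : 1 ≤ s) {u : ℕ → Fin m → ℝ} (hu : ∀ n, u (n + 1) = (P (s + n)).mulVec (u n))
    (h0 : ∑ i, u 0 i = 0) (k : ℕ) :
    ∃ q : ℕ, k ≤ (q + 2) * B₀ ∧
      ∑ i, u (k + 1) i ^ 2 ≤ ((1 - ζ / (4 * (m : ℝ) ^ 2)) ^ 2) ^ q * ∑ i, u 0 i ^ 2 := by
  obtain ⟨hA, hrow, hcol, hζ, -, hB, hdiag, hpos, -⟩ := id hnet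
  have hanti : Antitone fun n => ∑ i, u n i ^ 2 := by
    refine antitone_nat_of_succ_le fun n => ?_
    rw [hu]
    simpa using sum_sq_mulVec_add_gap_le (hA (s + n)) (hrow _) (hcol _) hζ (hdiag _) (hpos _)
      (x := u n) (r := fun _ => 0) (y := fun _ => 0) monotone_const (D := ∅) (by simp) (by simp)
  have hzero : ∀ n, ∑ i, u n i = 0 := by
    intro n
    induction n with
    | zero => exact h0
    | succ n ih =>
      rw [hu]
      simp only [Matrix.mulVec, dotProduct]
      rw [Finset.sum_comm]
      simp_rw [← Finset.sum_mul, hcol, one_mul, ih]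
  obtain ⟨n₀, q₀, hn₀, hq₀⟩ : ∃ n₀ q₀, n₀ < B₀ ∧ s + n₀ = q₀ * B₀ + 1 := by
    have hdm := Nat.div_add_mod (s - 1) B₀
    have hlt := Nat.mod_lt (s - 1) hB
    rw [mul_comm] at hdm
    by_cases h : (s - 1) % B₀ = 0
    · exact ⟨0, (s - 1) / B₀, hB, by omega⟩
    · exact ⟨B₀ - (s - 1) % B₀, (s - 1) / B₀ + 1, by omega, by rw [add_mul, one_mul]; omega⟩
  have hwin : ∀ q, ∑ i, u (n₀ + q * B₀) i ^ 2 ≤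
      ((1 - ζ / (4 * (m : ℝ) ^ 2)) ^ 2) ^ q * ∑ i, u 0 i ^ 2 := by
    intro q
    induction q with
    | zero => simpa using hanti (Nat.zero_le n₀)
    | succ q ih =>
      have h := hnet.sum_sq_window_le hm (q₀ + q) (u := fun n => u (n₀ + q * B₀ + n))
        (fun n => by
          rw [← add_assoc, hu]
          congr 2
          rw [add_mul]
          omega) (hzero _)
      rw [add_mul, one_mul, ← add_assoc, pow_succ', mul_assoc]
      exact h.trans (mul_le_mul_of_nonneg_left ih (sq_nonneg _))
  by_cases hk : n₀ ≤ k + 1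
  · have hdm := Nat.div_add_mod (k + 1 - n₀) B₀
    have hlt := Nat.mod_lt (k + 1 - n₀) hB
    rw [mul_comm] at hdm
    refine ⟨(k + 1 - n₀) / B₀, by rw [add_mul]; omega, le_trans (hanti ?_) (hwin _)⟩
    omega
  · exact ⟨0, by omega, by simpa using hanti (Nat.zero_le (k + 1))⟩

/-- **Geometric mixing of time-varying doubly stochastic matrices (Lemma 2).**
Under the network assumption, for all `t ≥ s ≥ 1` (here `t = s + k`) and all
`i, j`: `|[Q(t,s)]_{ij} − 1/m| ≤ ω γ^{t−s}`, with
`ω = (1 − ζ/(4m²))^{−2}` and `γ = (1 − ζ/(4m²))^{1/B₀}`. -/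
theorem geometric_mixing
    (m : ℕ) (hm : 1 ≤ m)
    (P : ℕ → Matrix (Fin m) (Fin m) ℝ) (ζ : ℝ) (B₀ : ℕ)
    (hnet : NetworkAssumption m P ζ B₀) :
    ∀ s : ℕ, 1 ≤ s → ∀ k : ℕ, ∀ i j : Fin m,
      |transQ P s k i j - 1 / m| ≤
        ((1 - ζ / (4 * (m : ℝ) ^ 2)) ^ 2)⁻¹ *
          ((1 - ζ / (4 * (m : ℝ) ^ 2)) ^ ((1 : ℝ) / (B₀ : ℝ))) ^ k := by
  intro s hs k i j
  obtain ⟨-, hrow, -, hζ, hζ1, hB, -⟩ := id hnet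
  have hm0 : (1 : ℝ) ≤ m := by exact_mod_cast hm
  have hm2 : (1 : ℝ) ≤ (m : ℝ) ^ 2 := one_le_pow₀ hm0
  set β : ℝ := 1 - ζ / (4 * (m : ℝ) ^ 2)
  have hβ1 : β ≤ 1 := sub_le_self _ (by positivity)
  have hβ0 : 0 < β := by
    refine sub_pos.2 ((div_lt_one (by positivity)).2 ?_)
    linarith
  let u : ℕ → Fin m → ℝ := fun n => Nat.casesOn n
    (fun i => (1 : Matrix (Fin m) (Fin m) ℝ) i j - 1 / m) fun k i => transQ P s k i j - 1 / m
  have hmul : ∀ (t : ℕ) (M : Matrix (Fin m) (Fin m) ℝ), (fun i => (P t * M) i j - 1 / (m : ℝ)) =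
      (P t).mulVec fun i => M i j - 1 / m := by
    intro t M
    ext i
    simp only [Matrix.mulVec, dotProduct, Matrix.mul_apply, mul_sub, Finset.sum_sub_distrib]
    rw [← Finset.sum_mul, hrow, one_mul]
  have hu : ∀ n, u (n + 1) = (P (s + n)).mulVec (u n) := by
    rintro (_ | n)
    · have h := hmul s 1
      rw [mul_one] at h
      exact h
    · exact hmul (s + n + 1) (transQ P s n)
  have huz : ∀ i, u 0 i = (if i = j then 1 else 0) - 1 / m := fun i => by
    exact congrArg (· - 1 / (m : ℝ)) Matrix.one_apply
  have hu0 : ∑ i, u 0 i = 0 := by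
    simp only [huz, Finset.sum_sub_distrib, Finset.sum_ite_eq', Finset.mem_univ, if_true,
      Finset.sum_const, Finset.card_univ, Fintype.card_fin, nsmul_eq_mul]
    field_simp
    ring
  have hu0sq : ∑ i, u 0 i ^ 2 ≤ 1 := by
    have h : ∀ i, u 0 i ^ 2 = (if i = j then 1 else 0) - u 0 i * (1 / m) -
        (if i = j then 1 else 0) * (1 / m) := by
      intro i
      rw [huz]
      split_ifs <;> ring
    simp_rw [h, Finset.sum_sub_distrib, ← Finset.sum_mul, hu0, Finset.sum_ite_eq',
      Finset.mem_univ, if_true]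
    have : (0 : ℝ) ≤ 1 / m := by positivity
    linarith
  obtain ⟨q, hq, hle⟩ := hnet.exists_sum_sq_le_pow hm hs hu hu0 k
  have hentry : |transQ P s k i j - 1 / m| ≤ β ^ q := by
    refine abs_le_of_sq_le_sq ?_ (by positivity)
    calc (transQ P s k i j - 1 / m) ^ 2 ≤ ∑ i, u (k + 1) i ^ 2 :=
          Finset.single_le_sum (f := fun i => u (k + 1) i ^ 2) (fun i _ => sq_nonneg _)
            (Finset.mem_univ i)
      _ ≤ (β ^ 2) ^ q * ∑ i, u 0 i ^ 2 := hle
      _ ≤ (β ^ 2) ^ q := mul_le_of_le_one_right (by positivity) hu0sq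
      _ = (β ^ q) ^ 2 := pow_right_comm β 2 q
  refine hentry.trans ?_
  rw [inv_mul_eq_div, le_div_iff₀ (by positivity), ← pow_add]
  have hroot : (β ^ ((1 : ℝ) / B₀)) ^ B₀ = β := by
    rw [one_div]
    exact Real.rpow_inv_natCast_pow hβ0.le (by omega)
  calc β ^ (q + 2) = (β ^ ((1 : ℝ) / B₀)) ^ ((q + 2) * B₀) := by
        rw [mul_comm, pow_mul, hroot]
    _ ≤ (β ^ ((1 : ℝ) / B₀)) ^ k :=
        pow_le_pow_of_le_one (by positivity)
          (Real.rpow_le_one hβ0.le hβ1 (by positivity)) hq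
end

section
/- (Consensus bound, Lemma 3.) Let B be a real normed vector space, m ≥ 1, and for each t ≥ 1 let P_t be an m×m doubly stochastic matrix (nonnegative entries, every row and column summing to 1). Suppose there exist ω > 0 and γ ∈ (0,1) such that the transition matrices Q(t,s) := P_t P_{t−1} ⋯ P_s satisfy |[Q(t,s)]_{ij} − 1/m| ≤ ω γ^{t−s} for all t ≥ s ≥ 1 and all i, j. Let f_{i,t} ∈ B and p_{i,t} ∈ B with ‖p_{i,t}‖ ≤ K for all i, t, and suppose f_{i,t+1} = Σ_{j=1}^m [P_t]_{ij}(f_{j,t} + p_{j,t}) for all i and t ≥ 1. Then, with f̄_t := (1/m) Σ_{j=1}^m f_{j,t}, for every i and every t ≥ 2: ‖f_{i,t} − f̄_t‖ ≤ ω γ^{t−2} Σ_{j=1}^m ‖f_{j,1}‖ + m ω K Σ_{s=1}^{t−1} γ^{t−1−s}. -/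
open Finset

/-- Column sums of a transition matrix are `1` when those of its factors are. -/
theorem sum_transQ_col {m : ℕ} {P : ℕ → Matrix (Fin m) (Fin m) ℝ}
    (hcol : ∀ t j, ∑ i, P t i j = 1) (s k : ℕ) (j : Fin m) :
    ∑ i, transQ P s k i j = 1 := by
  induction k with
  | zero => exact hcol s j
  | succ k ih =>
    simp only [transQ, Matrix.mul_apply]
    rw [sum_comm]
    simp only [← sum_mul, hcol, one_mul, ih]

section

variable {B : Type*} [NormedAddCommGroup B] [NormedSpace ℝ B] {m : ℕ}

theorem sum_smul_sum_smul (A C : Matrix (Fin m) (Fin m) ℝ) (v : Fin m → B) (i : Fin m) :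
    ∑ l, A i l • ∑ j, C l j • v j = ∑ j, (A * C) i j • v j := by
  simp only [Matrix.mul_apply, sum_smul, smul_sum, smul_smul]
  exact sum_comm

theorem sum_sum_smul_of_col {A : Matrix (Fin m) (Fin m) ℝ} (hA : ∀ j, ∑ i, A i j = 1)
    (v : Fin m → B) : ∑ i, ∑ j, A i j • v j = ∑ j, v j := by
  rw [sum_comm]
  simp only [← sum_smul, hA, one_smul]

/-- A row whose entries are within `c` of `1 / m` averages up to an error `c * ∑ j, ‖v j‖`. -/
theorem norm_sum_smul_sub_mean_le {A : Matrix (Fin m) (Fin m) ℝ} {i : Fin m} {c : ℝ}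
    (hA : ∀ j, |A i j - 1 / m| ≤ c) (v : Fin m → B) :
    ‖∑ j, A i j • v j - (m : ℝ)⁻¹ • ∑ j, v j‖ ≤ c * ∑ j, ‖v j‖ := by
  rw [smul_sum, ← sum_sub_distrib, mul_sum]
  refine norm_sum_le_of_le _ fun j _ => ?_
  rw [← sub_smul, norm_smul, Real.norm_eq_abs, ← one_div]
  exact mul_le_mul_of_nonneg_right (hA j) (norm_nonneg _)

/-- The recursion unrolled down to time `1`. -/
theorem consensus_unroll {P : ℕ → Matrix (Fin m) (Fin m) ℝ} {f p : ℕ → Fin m → B}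
    (hrec : ∀ t : ℕ, 1 ≤ t → ∀ i : Fin m, f (t + 1) i = ∑ j, P t i j • (f t j + p t j))
    (n : ℕ) (i : Fin m) :
    f (n + 2) i = ∑ j, transQ P 1 n i j • f 1 j +
      ∑ s ∈ Icc 1 (n + 1), ∑ j, transQ P s (n + 1 - s) i j • p s j := by
  induction n generalizing i with
  | zero => simp [hrec 1 le_rfl, transQ, smul_add, sum_add_distrib]
  | succ n ih =>
    rw [hrec (n + 2) (by omega), sum_Icc_succ_top (by omega)]
    simp only [smul_add, sum_add_distrib]
    simp only [ih, smul_add, sum_add_distrib, sum_smul_sum_smul]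
    rw [add_assoc]
    congr 1
    · rw [transQ, show 1 + n + 1 = n + 2 by omega]
    congr 1
    · simp only [smul_sum (s := Icc 1 (n + 1))]
      rw [sum_comm]
      refine sum_congr rfl fun s hs => ?_
      have hs' := (mem_Icc.mp hs).2
      rw [sum_smul_sum_smul, show n + 1 + 1 - s = (n + 1 - s) + 1 by omega, transQ,
        show s + (n + 1 - s) + 1 = n + 2 by omega]
    · simp [transQ]

end

/-- **Consensus bound (Lemma 3).** Let `P_t` be doubly stochastic matrices whose
transition matrices satisfy the geometric mixing bound
`|[Q(t,s)]_{ij} − 1/m| ≤ ω γ^{t−s}`. If `‖p_{i,t}‖ ≤ K` and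
`f_{i,t+1} = Σ_j [P_t]_{ij}(f_{j,t} + p_{j,t})` for `t ≥ 1`, then with
`f̄_t := (1/m) Σ_j f_{j,t}`, for every `i` and `t ≥ 2`:
`‖f_{i,t} − f̄_t‖ ≤ ω γ^{t−2} Σ_j ‖f_{j,1}‖ + m ω K Σ_{s=1}^{t−1} γ^{t−1−s}`. -/
theorem consensus_bound
    {B : Type*} [NormedAddCommGroup B] [NormedSpace ℝ B]
    (m : ℕ) (hm : 1 ≤ m)
    (P : ℕ → Matrix (Fin m) (Fin m) ℝ)
    (hnn : ∀ t i j, 0 ≤ P t i j)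
    (hrow : ∀ t i, ∑ j, P t i j = 1)
    (hcol : ∀ t j, ∑ i, P t i j = 1)
    (ω γ : ℝ) (hω : 0 < ω) (hγ0 : 0 < γ) (hγ1 : γ < 1)
    (hQ : ∀ s : ℕ, 1 ≤ s → ∀ k : ℕ, ∀ i j : Fin m,
      |transQ P s k i j - 1 / m| ≤ ω * γ ^ k)
    (f p : ℕ → Fin m → B) (K : ℝ)
    (hp : ∀ t : ℕ, 1 ≤ t → ∀ i : Fin m, ‖p t i‖ ≤ K)
    (hrec : ∀ t : ℕ, 1 ≤ t → ∀ i : Fin m,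
      f (t + 1) i = ∑ j, P t i j • (f t j + p t j)) :
    ∀ i : Fin m, ∀ t : ℕ, 2 ≤ t →
      ‖f t i - (m : ℝ)⁻¹ • ∑ j, f t j‖ ≤
        ω * γ ^ (t - 2) * ∑ j, ‖f 1 j‖
          + m * ω * K * ∑ s ∈ Icc 1 (t - 1), γ ^ (t - 1 - s) := by
  intro i t ht
  obtain ⟨n, rfl⟩ := Nat.exists_eq_add_of_le' ht
  have hmean : ∑ j, f (n + 2) j = ∑ j, f 1 j + ∑ s ∈ Icc 1 (n + 1), ∑ j, p s j := by
    simp only [consensus_unroll hrec, sum_add_distrib]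
    rw [sum_sum_smul_of_col (sum_transQ_col hcol 1 n), sum_comm]
    simp only [sum_sum_smul_of_col (sum_transQ_col hcol _ _)]
  rw [hmean, consensus_unroll hrec, smul_add, add_sub_add_comm, smul_sum (s := Icc 1 (n + 1)),
    ← sum_sub_distrib, show n + 2 - 2 = n by omega, show n + 2 - 1 = n + 1 by omega,
    mul_sum (s := Icc 1 (n + 1))]
  refine norm_add_le_of_le (norm_sum_smul_sub_mean_le (hQ 1 le_rfl n i) _)
    (norm_sum_le_of_le _ fun s hs => ?_)
  have hs1 := (mem_Icc.mp hs).1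
  calc _ ≤ ω * γ ^ (n + 1 - s) * ∑ j, ‖p s j‖ :=
        norm_sum_smul_sub_mean_le (hQ s hs1 (n + 1 - s) i) _
    _ ≤ ω * γ ^ (n + 1 - s) * ∑ _j : Fin m, K := by
        gcongr with j
        exact hp s hs1 j
    _ = m * ω * K * γ ^ (n + 1 - s) := by
        simp only [sum_const, card_univ, Fintype.card_fin, nsmul_eq_mul]
        ring
end

section
/- (Weighted telescoping bound, Proposition 4.) Let B be a real vector space, let Φ : B → ℝ be convex with Φ(g) ≥ 0 for all g ∈ B, let K ≥ 1 be an integer, and for each t ∈ {1,…,K} let P_t be an m×m doubly stochastic matrix. Let f̂_{i,t} ∈ B for i ∈ {1,…,m} and t ∈ {1,…,K+1}, and set f_{i,t} := Σ_{j=1}^m [P_t]_{ij} f̂_{j,t} for t ∈ {1,…,K}. Let 0 < V_1 ≤ V_2 ≤ ⋯ ≤ V_K be reals and 0 < v_1 ≤ V_1. Then Σ_{t=1}^K (1/V_t) Σ_{i=1}^m [Φ(f_{i,t}) − Φ(f̂_{i,t+1})] ≤ (1/v_1) Σ_{j=1}^m Φ(f̂_{j,1}) − (1/V_K) Σ_{j=1}^m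 Φ(f̂_{j,K+1}). -/
open Finset

/-- Averaging with nonnegative weights whose rows and columns sum to one does not increase the
total value of a convex function. -/
theorem ConvexOn.sum_map_sum_smul_le {ι V : Type*} [Fintype ι] [AddCommGroup V] [Module ℝ V]
    {Φ : V → ℝ} (hΦ : ConvexOn ℝ Set.univ Φ) {P : Matrix ι ι ℝ}
    (hnn : ∀ i j, 0 ≤ P i j) (hrow : ∀ i, ∑ j, P i j = 1) (hcol : ∀ j, ∑ i, P i j = 1)
    (g : ι → V) : ∑ i, Φ (∑ j, P i j • g j) ≤ ∑ j, Φ (g j) :=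
  calc ∑ i, Φ (∑ j, P i j • g j) ≤ ∑ i, ∑ j, P i j * Φ (g j) :=
        sum_le_sum fun i _ =>
          hΦ.map_sum_le (fun j _ => hnn i j) (hrow i) fun _ _ => Set.mem_univ _
    _ = ∑ j, Φ (g j) := by
        rw [sum_comm]
        simp only [← sum_mul, hcol, one_mul]

/-- A telescoping sum of a nonnegative sequence, weighted by the inverses of positive
nondecreasing weights. -/
theorem sum_Icc_one_div_mul_sub_le {S W : ℕ → ℝ} {v : ℝ} {n : ℕ} (hn : 1 ≤ n)
    (hS : ∀ t, 0 ≤ S t) (hv : 0 < v) (hvW : v ≤ W 1)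
    (hmono : ∀ t ∈ Icc 1 n, ∀ s ∈ Icc 1 n, t ≤ s → W t ≤ W s) :
    ∑ t ∈ Icc 1 n, 1 / W t * (S t - S (t + 1)) ≤ 1 / v * S 1 - 1 / W n * S (n + 1) := by
  induction n, hn using Nat.le_induction with
  | base =>
    have h := mul_le_mul_of_nonneg_right (one_div_le_one_div_of_le hv hvW) (hS 1)
    simp only [Icc_self, sum_singleton]
    linarith
  | succ n hn ih =>
    have ih := ih fun t ht s hs => hmono t (Icc_subset_Icc_right n.le_succ ht) s
      (Icc_subset_Icc_right n.le_succ hs)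
    have hpos : 0 < W n := hv.trans_le <| hvW.trans <|
      hmono 1 (by simp) n (by simp [hn]) hn
    have hstep : W n ≤ W (n + 1) := hmono n (by simp [hn]) (n + 1) (by simp) n.le_succ
    have h := mul_le_mul_of_nonneg_right (one_div_le_one_div_of_le hpos hstep) (hS (n + 1))
    rw [sum_Icc_succ_top (by omega)]
    linarith

/-- **Weighted telescoping bound (Proposition 4).**
Let `Φ : V → ℝ` be convex and nonnegative, `P_t` doubly stochastic matrices for
`t = 1, …, K`, `f̂_{i,t} ∈ V` for `t = 1, …, K+1`, and
`f_{i,t} := Σ_j [P_t]_{ij} f̂_{j,t}`. For reals `0 < v₁ ≤ V_1 ≤ ⋯ ≤ V_K`: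
`Σ_{t=1}^K (1/V_t) Σ_i [Φ(f_{i,t}) − Φ(f̂_{i,t+1})]
  ≤ (1/v₁) Σ_j Φ(f̂_{j,1}) − (1/V_K) Σ_j Φ(f̂_{j,K+1})`. -/
theorem weighted_telescoping_bound
    {V : Type*} [AddCommGroup V] [Module ℝ V]
    (m K : ℕ) (hK : 1 ≤ K)
    (Φ : V → ℝ) (hΦ : ConvexOn ℝ Set.univ Φ) (hΦnn : ∀ g : V, 0 ≤ Φ g)
    (P : ℕ → Matrix (Fin m) (Fin m) ℝ)
    (hnn : ∀ t ∈ Icc 1 K, ∀ i j, 0 ≤ P t i j)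
    (hrow : ∀ t ∈ Icc 1 K, ∀ i, ∑ j, P t i j = 1)
    (hcol : ∀ t ∈ Icc 1 K, ∀ j, ∑ i, P t i j = 1)
    (fhat f : ℕ → Fin m → V)
    (hf : ∀ t ∈ Icc 1 K, ∀ i, f t i = ∑ j, P t i j • fhat t j)
    (W : ℕ → ℝ) (v₁ : ℝ) (hv₁ : 0 < v₁) (hv₁W : v₁ ≤ W 1)
    (hmono : ∀ t ∈ Icc 1 K, ∀ s ∈ Icc 1 K, t ≤ s → W t ≤ W s) :
    ∑ t ∈ Icc 1 K, (1 / W t) * ∑ i, (Φ (f t i) - Φ (fhat (t + 1) i)) ≤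
      (1 / v₁) * ∑ j, Φ (fhat 1 j) - (1 / W K) * ∑ j, Φ (fhat (K + 1) j) := by
  refine (sum_le_sum fun t ht => ?_).trans
    (sum_Icc_one_div_mul_sub_le (S := fun t => ∑ j, Φ (fhat t j)) hK
      (fun t => sum_nonneg fun j _ => hΦnn _) hv₁ hv₁W hmono)
  have hpos : 0 < W t := hv₁.trans_le <| hv₁W.trans <|
    hmono 1 (by simp [hK]) t ht (mem_Icc.1 ht).1
  have hJensen := hΦ.sum_map_sum_smul_le (hnn t ht) (hrow t ht) (hcol t ht) (fhat t)
  simp only [sum_sub_distrib, hf t ht]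
  gcongr
end

section
/- (One-step descent for distributed functional gradient descent, Proposition 7.) Let H be a real Hilbert space, m ≥ 1, L ≥ 0, η > 0, and let J_1,…,J_m : H → ℝ be Fréchet differentiable with gradients ∇J_i satisfying the L-smoothness inequality J_i(f) ≤ J_i(g) + ⟨f − g, ∇J_i(g)⟩ + (L/2)‖f − g‖² for all f, g ∈ H. Let P be an m×m doubly stochastic matrix, let f_1,…,f_m ∈ H, and set f_i⁺ := Σ_{j=1}^m [P]_{ij}(f_j − η ∇J_j(f_j)), f̄ := (1/m) Σ_{i=1}^m f_i, and f̄⁺ := (1/m) Σ_{i=1}^m f_i⁺. Then, with J := Σ_{i=1}^m J_i and ∇J := Σ_{i=1}^m ∇J_i: J(f̄⁺) − J(f̄) ≤ (η/2 + Lη²) Σ_{i=1}^m ‖∇J_i(f_i) − ∇J_i(f̄)‖² − (η/(2m) − Lη²/m) ‖∇J(f̄)‖². -/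
open Finset
open scoped RealInnerProductSpace

/-- Columns summing to one make the weighted mixing preserve the total. -/
theorem sum_sum_smul_of_col_sum_eq_one {ι E : Type*} [Fintype ι] [AddCommGroup E] [Module ℝ E]
    (P : Matrix ι ι ℝ) (hcol : ∀ j, ∑ i, P i j = 1) (v : ι → E) :
    ∑ i, ∑ j, P i j • v j = ∑ j, v j := by
  rw [Finset.sum_comm]
  simp [← Finset.sum_smul, hcol]

theorem norm_sq_sum_le_card_mul_sum_norm_sq {ι E : Type*} [Fintype ι] [SeminormedAddCommGroup E]
    (v : ι → E) : ‖∑ i, v i‖ ^ 2 ≤ Fintype.card ι * ∑ i, ‖v i‖ ^ 2 :=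
  (pow_le_pow_left₀ (norm_nonneg _) (norm_sum_le _ _) 2).trans sq_sum_le_card_mul_sum_sq

/-- **One-step descent for distributed functional gradient descent
(Proposition 7).** In a real Hilbert space `H`, with `L`-smooth Fréchet
differentiable `J_i` (gradients `∇J_i`), a doubly stochastic matrix `P`, points
`f_i`, and `f_i⁺ := Σ_j P i j • (f_j − η ∇J_j(f_j))`, writing `f̄`, `f̄⁺` for the
averages and `J := Σ_i J_i`, `∇J := Σ_i ∇J_i`:
`J(f̄⁺) − J(f̄) ≤ (η/2 + Lη²) Σ_i ‖∇J_i(f_i) − ∇J_i(f̄)‖²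
  − (η/(2m) − Lη²/m) ‖∇J(f̄)‖²`. -/
theorem dfgd_one_step_descent
    {H : Type*} [NormedAddCommGroup H] [InnerProductSpace ℝ H] [CompleteSpace H]
    (m : ℕ) (hm : 1 ≤ m) (L η : ℝ) (hL : 0 ≤ L) (hη : 0 < η)
    (J : Fin m → H → ℝ) (gJ : Fin m → H → H)
    (hdiff : ∀ (i : Fin m) (f : H), HasGradientAt (J i) (gJ i f) f)
    (hsmooth : ∀ (i : Fin m) (f g : H),
      J i f ≤ J i g + ⟪f - g, gJ i g⟫ + L / 2 * ‖f - g‖ ^ 2)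
    (P : Matrix (Fin m) (Fin m) ℝ)
    (hnn : ∀ i j, 0 ≤ P i j)
    (hrow : ∀ i, ∑ j, P i j = 1)
    (hcol : ∀ j, ∑ i, P i j = 1)
    (f fplus : Fin m → H) (fbar fbarplus : H)
    (hfplus : ∀ i, fplus i = ∑ j, P i j • (f j - η • gJ j (f j)))
    (hfbar : fbar = (m : ℝ)⁻¹ • ∑ i, f i)
    (hfbarplus : fbarplus = (m : ℝ)⁻¹ • ∑ i, fplus i) :
    (∑ i, J i fbarplus) - (∑ i, J i fbar) ≤
      (η / 2 + L * η ^ 2) * ∑ i, ‖gJ i (f i) - gJ i fbar‖ ^ 2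
        - (η / (2 * m) - L * η ^ 2 / m) * ‖∑ i, gJ i fbar‖ ^ 2 := by
  have hm0 : (0 : ℝ) < m := by exact_mod_cast hm
  set G := ∑ i, gJ i fbar with hG
  set E := ∑ i, (gJ i (f i) - gJ i fbar) with hE
  set S := ∑ i, ‖gJ i (f i) - gJ i fbar‖ ^ 2
  have hstep : fbarplus - fbar = -((η / m) • (G + E)) := by
    have hsum : ∑ i, fplus i = ∑ i, f i - η • (G + E) := by
      simp only [hfplus, hG, hE]
      rw [sum_sum_smul_of_col_sum_eq_one P hcol, Finset.sum_sub_distrib, ← Finset.smul_sum,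
        Finset.sum_sub_distrib, add_sub_cancel]
    rw [hfbarplus, hfbar, hsum, smul_sub, smul_smul, div_eq_inv_mul]
    abel
  have hdescent : (∑ i, J i fbarplus) - (∑ i, J i fbar) ≤
      ⟪fbarplus - fbar, G⟫ + m * (L / 2 * ‖fbarplus - fbar‖ ^ 2) := by
    have h := Finset.sum_le_sum fun i (_ : i ∈ Finset.univ) => hsmooth i fbarplus fbar
    simp only [Finset.sum_add_distrib, ← inner_sum, Finset.sum_const, Finset.card_univ,
      Fintype.card_fin, nsmul_eq_mul] at h
    linarith
  have hES : ‖E‖ ^ 2 ≤ m * S := by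
    simpa only [Fintype.card_fin] using
      norm_sq_sum_le_card_mul_sum_norm_sq fun i => gJ i (f i) - gJ i fbar
  have hplus := norm_add_sq_real G E
  have hminus := norm_sub_sq_real G E
  have hinner : ⟪fbarplus - fbar, G⟫ = -(η / m) * (‖G‖ ^ 2 + ⟪G, E⟫) := by
    rw [hstep, inner_neg_left, real_inner_smul_left, inner_add_left, real_inner_self_eq_norm_sq,
      real_inner_comm E G]
    ring
  have hnorm : ‖fbarplus - fbar‖ ^ 2 = (η / m) ^ 2 * ‖G + E‖ ^ 2 := by
    rw [hstep, norm_neg, norm_smul, mul_pow, Real.norm_eq_abs, sq_abs]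
  have hcross : -(‖G‖ ^ 2 + ⟪G, E⟫) ≤ (m * S - ‖G‖ ^ 2) / 2 := by
    nlinarith [sq_nonneg ‖G + E‖]
  have hsq : ‖G + E‖ ^ 2 ≤ 2 * (‖G‖ ^ 2 + m * S) := by
    nlinarith [sq_nonneg ‖G - E‖]
  rw [hinner, hnorm] at hdescent
  calc _ ≤ η / m * -(‖G‖ ^ 2 + ⟪G, E⟫) + m * (L / 2 * ((η / m) ^ 2 * ‖G + E‖ ^ 2)) := by
        linarith
    _ ≤ η / m * ((m * S - ‖G‖ ^ 2) / 2)
        + m * (L / 2 * ((η / m) ^ 2 * (2 * (‖G‖ ^ 2 + m * S)))) := by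
        gcongr
    _ = _ := by
        field_simp
        ring
end
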